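/- Let n ≥ 2 and 2 ≤ k ≤ n. If κ = (κ_1, …, κ_n) ∈ Γ_k ⊂ ℝⁿ, then for every index i the (n−1)-tuple (κ|i), obtained from κ by deleting the entry κ_i, lies in the Garding cone Γ_{k−1} of ℝ^{n−1}; that is, σ_j(κ|i) > 0 for all 1 ≤ j ≤ k−1. -/

import Mathlib

open Finset

/-- The `k`-th elementary symmetric polynomial of `κ : Fin n → ℝ`. -/
noncomputable def esymm {n : ℕ} (k : ℕ) (κ : Fin n → ℝ) : ℝ :=
  ∑ s ∈ Finset.univ.powersetCard k, ∏ i ∈ s, κ i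

/-- `σ_k(κ|i)`: the `k`-th elementary symmetric polynomial of the tuple obtained
from `κ` by deleting the entry `κ i`. -/
noncomputable def esymmDel {n : ℕ} (k : ℕ) (κ : Fin n → ℝ) (i : Fin n) : ℝ :=
  ∑ s ∈ ({i}ᶜ : Finset (Fin n)).powersetCard k, ∏ j ∈ s, κ j

/-- `σ_k(κ|i,j)`: the `k`-th elementary symmetric polynomial of the tuple obtained
from `κ` by deleting the entries `κ i` and `κ j`. -/
noncomputable def esymmDel2 {n : ℕ} (k : ℕ) (κ : Fin n → ℝ) (i j : Fin n) : ℝ :=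
  ∑ s ∈ ({i, j}ᶜ : Finset (Fin n)).powersetCard k, ∏ l ∈ s, κ l

/-- The Garding cone `Γ_k = {κ : σ_j(κ) > 0 for all 1 ≤ j ≤ k}`. -/
def GardingCone {n : ℕ} (k : ℕ) : Set (Fin n → ℝ) :=
  {κ | ∀ j : ℕ, 1 ≤ j → j ≤ k → 0 < esymm j κ}

open Polynomial in
lemma splits_derivative_real (p : ℝ[X]) (hp : p.Splits) : (derivative p).Splits := by
  by_cases h0 : p.natDegree = 0
  · rw [natDegree_eq_zero] at h0
    obtain ⟨c, rfl⟩ := h0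
    simp
  rw [splits_iff_card_roots] at hp ⊢
  have h1 := card_roots_le_derivative p
  have h2 := card_roots' (derivative p)
  have h3 := natDegree_derivative_lt h0
  omega

open Polynomial in
lemma splits_iterate_derivative_real (p : ℝ[X]) (hp : p.Splits) (l : ℕ) :
    (derivative^[l] p).Splits := by
  induction l with
  | zero => simpa
  | succ l ih =>
    rw [Function.iterate_succ_apply']
    exact splits_derivative_real _ ih

open Polynomial in
lemma splits_coeff_ineq (p : ℝ[X]) (hp : p.Splits) :
    2 * p.coeff 0 * p.coeff 2 ≤ p.coeff 1 ^ 2 := by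
  rw [splits_iff_exists_multiset] at hp
  obtain ⟨m, hm⟩ := hp
  have key : ∀ m : Multiset ℝ, 2 * (m.map (fun a => X - C a)).prod.coeff 0 *
      (m.map (fun a => X - C a)).prod.coeff 2 ≤ (m.map (fun a => X - C a)).prod.coeff 1 ^ 2 := by
    intro m
    induction m using Multiset.induction with
    | empty => simp [coeff_one]
    | cons a s ih =>
      rw [Multiset.map_cons, Multiset.prod_cons]
      set q := (s.map (fun a => X - C a)).prod
      have e0 : ((X - C a) * q).coeff 0 = - a * q.coeff 0 := by simp [sub_mul]
      have e1 : ((X - C a) * q).coeff 1 = q.coeff 0 - a * q.coeff 1 := by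
        simp [sub_mul, coeff_X_mul]
      have e2 : ((X - C a) * q).coeff 2 = q.coeff 1 - a * q.coeff 2 := by
        simp [sub_mul, coeff_X_mul]
      rw [e0, e1, e2]
      nlinarith [mul_nonneg (sq_nonneg a) (sub_nonneg.2 ih), sq_nonneg (q.coeff 0)]
  rw [hm]
  simp only [coeff_C_mul]
  nlinarith [mul_nonneg (sq_nonneg p.leadingCoeff) (sub_nonneg.2 (key m))]

open Polynomial in
lemma splits_coeff_log_concave (p : ℝ[X]) (hp : p.Splits) (l : ℕ) :
    p.coeff l * p.coeff (l + 2) ≤ p.coeff (l + 1) ^ 2 := by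
  have h := splits_coeff_ineq _ (splits_iterate_derivative_real p hp l)
  simp only [coeff_iterate_derivative, nsmul_eq_mul] at h
  rw [zero_add, add_comm 1 l, add_comm 2 l] at h
  have d0 : ((l.descFactorial l : ℕ) : ℝ) = (l.factorial : ℝ) := by rw [Nat.descFactorial_self]
  have d1 : (((l + 1).descFactorial l : ℕ) : ℝ) = (l + 1) * (l.factorial : ℝ) := by
    have := Nat.factorial_mul_descFactorial (n := l + 1) (k := l) (by omega)
    rw [show l + 1 - l = 1 by omega, Nat.factorial_one, one_mul, Nat.factorial_succ l] at this
    rw [this]; push_cast; ring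
  have d2 : 2 * (((l + 2).descFactorial l : ℕ) : ℝ) = (l + 2) * (l + 1) * (l.factorial : ℝ) := by
    have := Nat.factorial_mul_descFactorial (n := l + 2) (k := l) (by omega)
    rw [show l + 2 - l = 2 by omega, Nat.factorial_two,
      Nat.factorial_succ (l + 1), Nat.factorial_succ l] at this
    have h' : ((2 * (l + 2).descFactorial l : ℕ) : ℝ) = ((l + 1 + 1) * ((l + 1) * l.factorial) : ℕ) := by
      rw [← this]
    push_cast at h'
    rw [h']; ring
  rw [d0, d1] at h
  have hf : (0 : ℝ) < l.factorial := by positivity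
  have hl : (0 : ℝ) ≤ l := by positivity
  set F : ℝ := (l.factorial : ℝ)
  set a := p.coeff l
  set b := p.coeff (l + 1)
  set c := p.coeff (l + 2)
  have h2 : F ^ 2 * (l + 1) * ((l + 2) * (a * c)) ≤ F ^ 2 * (l + 1) * ((l + 1) * b ^ 2) := by
    calc _ = F * a * ((l + 2) * (l + 1) * F) * c := by ring
      _ = _ := by rw [← d2]
      _ = 2 * (F * a) * (((l + 2).descFactorial l : ℕ) * c) := by ring
      _ ≤ _ := h
      _ = _ := by ring
  have h3 := le_of_mul_le_mul_left h2 (by positivity)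
  by_contra hcon
  push Not at hcon
  nlinarith [sq_nonneg b, mul_le_mul_of_nonneg_left hcon.le hl]

lemma newton_weak {n : ℕ} (s : Finset (Fin n)) (κ : Fin n → ℝ) (j : ℕ) (hj : j + 2 ≤ #s) :
    (∑ t ∈ s.powersetCard j, ∏ i ∈ t, κ i) * (∑ t ∈ s.powersetCard (j + 2), ∏ i ∈ t, κ i) ≤
      (∑ t ∈ s.powersetCard (j + 1), ∏ i ∈ t, κ i) ^ 2 := by
  have h := splits_coeff_log_concave (∏ i ∈ s, (Polynomial.X + Polynomial.C (κ i)))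
    (Polynomial.Splits.prod fun i _ => Polynomial.Splits.X_add_C _) (#s - (j + 2))
  rw [Finset.prod_X_add_C_coeff _ _ (by omega), Finset.prod_X_add_C_coeff _ _ (by omega),
    Finset.prod_X_add_C_coeff _ _ (by omega)] at h
  rw [show #s - (#s - (j + 2)) = j + 2 by omega, show #s - (#s - (j + 2) + 2) = j by omega,
    show #s - (#s - (j + 2) + 1) = j + 1 by omega] at h
  linarith

lemma newton_esymmDel {n : ℕ} (κ : Fin n → ℝ) (i : Fin n) (j : ℕ) :
    esymmDel j κ i * esymmDel (j + 2) κ i ≤ esymmDel (j + 1) κ i ^ 2 := by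
  by_cases hj : j + 2 ≤ #({i}ᶜ : Finset (Fin n))
  · exact newton_weak _ κ j hj
  · have : esymmDel (j + 2) κ i = 0 := by
      unfold esymmDel
      rw [Finset.powersetCard_eq_empty.2 (by omega), Finset.sum_empty]
    rw [this, mul_zero]
    positivity

lemma esymm_succ_eq {n : ℕ} (κ : Fin n → ℝ) (i : Fin n) (j : ℕ) :
    esymm (j + 1) κ = esymmDel (j + 1) κ i + κ i * esymmDel j κ i := by
  unfold esymm esymmDel
  have hi : i ∉ ({i}ᶜ : Finset (Fin n)) := by simp
  have hu : (Finset.univ : Finset (Fin n)) = insert i {i}ᶜ := by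
    ext x; simp [em]
  have hni : ∀ t ∈ ({i}ᶜ : Finset (Fin n)).powersetCard j, i ∉ t := fun t ht hit =>
    hi ((Finset.mem_powersetCard.1 ht).1 hit)
  rw [hu, Finset.powersetCard_succ_insert hi, Finset.sum_union, Finset.sum_image, Finset.mul_sum]
  · congr 1
    exact Finset.sum_congr rfl fun t ht => Finset.prod_insert (hni t ht)
  · intro a ha b hb hab
    rw [← Finset.erase_insert (hni a ha), ← Finset.erase_insert (hni b hb), hab]
  · rw [Finset.disjoint_left]
    intro t ht ht'
    obtain ⟨u, _, rfl⟩ := Finset.mem_image.1 ht'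
    exact hi ((Finset.mem_powersetCard.1 ht).1 (Finset.mem_insert_self _ _))

/-- If `κ ∈ Γ_k`, then the deleted tuple `(κ|i)` lies in the Garding cone `Γ_{k-1}`,
i.e. `σ_j(κ|i) > 0` for all `1 ≤ j ≤ k-1`. -/
theorem stmt_6 (n k : ℕ) (hn : 2 ≤ n) (hk1 : 2 ≤ k) (hk2 : k ≤ n)
    (κ : Fin n → ℝ) (hκ : κ ∈ GardingCone k) (i : Fin n) :
    ∀ j : ℕ, 1 ≤ j → j ≤ k - 1 → 0 < esymmDel j κ i := by
  have main : ∀ j : ℕ, j ≤ k - 1 → 0 < esymmDel j κ i := by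
    intro j
    induction j with
    | zero => intro _; simp [esymmDel]
    | succ j ih =>
      intro hj
      have h0 := ih (by omega)
      have h1 := hκ (j + 1) (by omega) (by omega)
      have h2 := hκ (j + 1 + 1) (by omega) (by omega)
      rw [esymm_succ_eq κ i] at h1 h2
      have hN := newton_esymmDel κ i j
      by_contra hcon
      push Not at hcon
      have e1 := mul_lt_mul_of_pos_left h2 h0
      have e2 := mul_nonneg (neg_nonneg.2 hcon) h1.le
      nlinarith
  exact fun j _ hj => main j hj
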